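/- arXiv:2306.00350 — 3 statements merged into one kernel-verified Lean document; each statement's English description precedes it below -/
import Mathlib

section
/- Theorem 2 (deviation bound for IESL rest points): Assume that for every player i and every fixed opponent profile π̄^{−i}, the individual utility function π^i ↦ u^i(π^i, π̄^{−i}) is concave on the convex set Π^i (a product of probability simplices). Then for every ε > 0, every rest point ȳ_ε of the IESL dynamic (i.e. every score with w(σ(ȳ_ε)) = ȳ_ε) induces the joint policy π̄_ε = σ(ȳ_ε), and π̄_ε is an ε′-Nash equilibrium with ε′ = ε · log|A| · Σ_{k=0}^{T−1} γ^k. -/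
open scoped Classical BigOperators

noncomputable section

/-- An `n`-player finite-horizon imperfect-information game with simultaneous moves
(a finite-horizon POSG).  `Obs` is the joint-observation kernel, `O0` the initial
joint-observation kernel, `Tr` the transition kernel, `R` the reward functions. -/
structure POSG where
  n : ℕ
  n_pos : 0 < n
  S : Type
  [S_fin : Fintype S]
  [S_ne : Nonempty S]
  Z : Fin n → Type
  [Z_fin : ∀ i, Fintype (Z i)]
  [Z_ne : ∀ i, Nonempty (Z i)]
  A : Type
  [A_fin : Fintype A]
  [A_ne : Nonempty A]
  T : ℕ
  T_pos : 1 ≤ T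
  γ : ℝ
  γ_pos : 0 < γ
  γ_le_one : γ ≤ 1
  ρ : S → ℝ
  ρ_nonneg : ∀ s, 0 ≤ ρ s
  ρ_sum : ∑ s, ρ s = 1
  O0 : S → (∀ i, Z i) → ℝ
  O0_nonneg : ∀ s z, 0 ≤ O0 s z
  O0_sum : ∀ s, ∑ z, O0 s z = 1
  Tr : S → (Fin n → A) → S → ℝ
  Tr_nonneg : ∀ s a s', 0 ≤ Tr s a s'
  Tr_sum : ∀ s a, ∑ s', Tr s a s' = 1
  Obs : S → (Fin n → A) → S → (∀ i, Z i) → ℝ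
  Obs_nonneg : ∀ s a s' z, 0 ≤ Obs s a s' z
  Obs_sum : ∀ s a s', ∑ z, Obs s a s' z = 1
  R : Fin n → S → (Fin n → A) → S → ℝ

attribute [instance] POSG.S_fin POSG.S_ne POSG.Z_fin POSG.Z_ne POSG.A_fin POSG.A_ne

/-- Softmax choice map with regularization parameter `ε`. -/
def softmax {α : Type*} [Fintype α] (ε : ℝ) (y : α → ℝ) (a : α) : ℝ :=
  Real.exp (y a / ε) / ∑ b, Real.exp (y b / ε)

/-- Negative Gibbs entropy `H(p) = ∑ₐ p a * log (p a)` (with `0 * log 0 = 0`). -/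
def negEnt {α : Type*} [Fintype α] (p : α → ℝ) : ℝ := ∑ a, p a * Real.log (p a)

namespace POSG

variable (G : POSG)

/-- Joint actions. -/
abbrev JointAct := Fin G.n → G.A

/-- Tuples of observations, one for each player. -/
abbrev ObsTuple := ∀ i, G.Z i

/-- Global histories at step `t`:
`h_t = (s_0, z̄_0, ā_0, …, ā_{t-1}, s_t, z̄_t)`. -/
abbrev Hist (t : ℕ) := (Fin (t + 1) → G.S) × (Fin (t + 1) → G.ObsTuple) × (Fin t → G.JointAct)

/-- Local trajectories (information sets) of player `i` at step `t`:
`x_t^i = (z_0^i, a_0^i, …, a_{t-1}^i, z_t^i)`. -/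
abbrev LocTraj (i : Fin G.n) (t : ℕ) := (Fin (t + 1) → G.Z i) × (Fin t → G.A)

/-- Reduction of a global history to player `i`'s local trajectory;
`h ∈ x` is expressed as `G.red i h = x`. -/
def red (i : Fin G.n) {t : ℕ} (h : G.Hist t) : G.LocTraj i t :=
  (fun k => h.2.1 k i, fun k => h.2.2 k i)

/-- A policy of player `i` assigns to every local trajectory a vector of action weights. -/
abbrev Policy (i : Fin G.n) := ∀ t : Fin G.T, G.LocTraj i t.1 → G.A → ℝ

/-- Joint policies. -/
abbrev JointPolicy := ∀ i : Fin G.n, G.Policy i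

/-- The score space: one real number for each information-set–action pair. -/
abbrev Score := ∀ i : Fin G.n, ∀ t : Fin G.T, G.LocTraj i t.1 → G.A → ℝ

/-- `p` is a genuine (probability-simplex valued) policy. -/
def IsPolicy {i : Fin G.n} (p : G.Policy i) : Prop :=
  (∀ t x a, 0 ≤ p t x a) ∧ (∀ t x, ∑ a, p t x a = 1)

def IsJointPolicy (π : G.JointPolicy) : Prop := ∀ i, G.IsPolicy (π i)

/-- Fully mixed joint policy: all actions have positive probability everywhere. -/
def FullyMixed (π : G.JointPolicy) : Prop := ∀ i t x a, 0 < π i t x a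

/-- Current (last) state of a history. -/
def lastState {t : ℕ} (h : G.Hist t) : G.S := h.1 (Fin.last t)

/-- Probability of a joint action at a history under a joint policy. -/
def polProb (π : G.JointPolicy) {t : ℕ} (h : G.Hist t) (a : G.JointAct) : ℝ :=
  if ht : t < G.T then ∏ i, π i ⟨t, ht⟩ (G.red i h) (a i) else 0

/-- Extension of a history by one step. -/
def extend {t : ℕ} (h : G.Hist t) (a : G.JointAct) (s' : G.S) (z' : G.ObsTuple) :
    G.Hist (t + 1) :=
  (Fin.snoc h.1 s', Fin.snoc h.2.1 z', Fin.snoc h.2.2 a)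

/-- The one-step-shorter prefix of a history. -/
def front {t : ℕ} (h : G.Hist (t + 1)) : G.Hist t :=
  (fun k => h.1 k.castSucc, fun k => h.2.1 k.castSucc, fun k => h.2.2 k.castSucc)

/-- `Pr(h_t | π̄)`: the product of the initial, transition, observation and policy
probabilities along the history. -/
def histProb (π : G.JointPolicy) : (t : ℕ) → G.Hist t → ℝ
  | 0, h => G.ρ (h.1 0) * G.O0 (h.1 0) (h.2.1 0)
  | (t + 1), h =>
      histProb π t (G.front h) * G.polProb π (G.front h) (h.2.2 (Fin.last t)) *
        G.Tr (G.lastState (G.front h)) (h.2.2 (Fin.last t)) (G.lastState h) *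
        G.Obs (G.lastState (G.front h)) (h.2.2 (Fin.last t)) (G.lastState h)
          (h.2.1 (Fin.last (t + 1)))

/-- Auxiliary (fuel-indexed) value recursion. -/
def valAux (π : G.JointPolicy) (i : Fin G.n) : ℕ → (t : ℕ) → G.Hist t → ℝ
  | 0, _, _ => 0
  | (fuel + 1), t, h =>
      if t < G.T then
        ∑ a : G.JointAct, ∑ s' : G.S, ∑ z' : G.ObsTuple,
          G.polProb π h a * G.Tr (G.lastState h) a s' * G.Obs (G.lastState h) a s' z' *
            (G.R i (G.lastState h) a s' + G.γ * valAux π i fuel (t + 1) (G.extend h a s' z'))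
      else 0

/-- `V^i_π̄(h_t) = E[ ∑_{k=t}^{T-1} γ^{k-t} R^i(s_k, ā_k, s_{k+1}) | h_t, π̄ ]`. -/
def V (π : G.JointPolicy) (i : Fin G.n) {t : ℕ} (h : G.Hist t) : ℝ :=
  G.valAux π i (G.T - t) t h

/-- `Q^i_π̄(h_t, a^i)`: expected value conditioned on player `i` playing `a^i` at `h_t`
while the other players follow `π̄`. -/
def Q (π : G.JointPolicy) (i : Fin G.n) {t : ℕ} (h : G.Hist t) (ai : G.A) : ℝ :=
  if ht : t < G.T then
    ∑ a : G.JointAct, ∑ s' : G.S, ∑ z' : G.ObsTuple,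
      (if a i = ai then ∏ j ∈ Finset.univ.erase i, π j ⟨t, ht⟩ (G.red j h) (a j) else 0) *
        G.Tr (G.lastState h) a s' * G.Obs (G.lastState h) a s' z' *
        (G.R i (G.lastState h) a s' + G.γ * G.V π i (G.extend h a s' z'))
  else 0

/-- The advantage function `A^i_π̄(h_t, a^i) = Q^i_π̄(h_t, a^i) − V^i_π̄(h_t)`. -/
def Adv (π : G.JointPolicy) (i : Fin G.n) {t : ℕ} (h : G.Hist t) (ai : G.A) : ℝ :=
  G.Q π i h ai - G.V π i h

/-- The initial history determined by `s_0` and `z̄_0`. -/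
def hist0 (s : G.S) (z : G.ObsTuple) : G.Hist 0 :=
  (fun _ => s, fun _ => z, fun k => k.elim0)

/-- The utility `u^i(π̄) = E_{h_0}[ V^i_π̄(h_0) ]`. -/
def u (π : G.JointPolicy) (i : Fin G.n) : ℝ :=
  ∑ s : G.S, ∑ z : G.ObsTuple, G.ρ s * G.O0 s z * G.V π i (G.hist0 s z)

/-- `∑_{h_t ∈ x_t^i} Pr(h_t | π̄)`: reaching probability of an information set. -/
def reach (π : G.JointPolicy) (i : Fin G.n) {t : ℕ} (x : G.LocTraj i t) : ℝ :=
  ∑ h : G.Hist t, if G.red i h = x then G.histProb π t h else 0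

/-- `∑_{h_t ∈ x_t^i} Pr(h_t | π̄) A^i_π̄(h_t, a)`. -/
def advW (π : G.JointPolicy) (i : Fin G.n) {t : ℕ} (x : G.LocTraj i t) (a : G.A) : ℝ :=
  ∑ h : G.Hist t, if G.red i h = x then G.histProb π t h * G.Adv π i h a else 0

/-- The local advantage map `w`. -/
def w (π : G.JointPolicy) : G.Score :=
  fun i t x a => G.advW π i x a / G.reach π i x

/-- The regularized choice map `σ` (softmax with parameter `ε`). -/
def choice (ε : ℝ) (y : G.Score) : G.JointPolicy :=
  fun i t x a => softmax ε (y i t x) a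

/-- Assumption: every local trajectory contains some history with positive probability
under fully mixed joint policies. -/
def ReachPos : Prop :=
  ∀ π : G.JointPolicy, G.IsJointPolicy π → G.FullyMixed π →
    ∀ (i : Fin G.n) (t : Fin G.T) (x : G.LocTraj i t.1), 0 < G.reach π i x

/-- The discounted entropy-regularization term
`ε ∑_{t<T} γ^t ∑_{x_t^i} H(p(x_t^i)) ∑_{h_t ∈ x_t^i} Pr(h_t | π_reach)`. -/
def entReg (ε : ℝ) {i : Fin G.n} (p : G.Policy i) (πreach : G.JointPolicy) : ℝ :=
  ε * ∑ t : Fin G.T, G.γ ^ (t : ℕ) *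
    ∑ x : G.LocTraj i t.1, negEnt (p t x) * G.reach πreach i x

/-- Nash distribution with modification-L (parameter `ε`). -/
def NashDistL (ε : ℝ) (πL : G.JointPolicy) : Prop :=
  ∀ (i : Fin G.n) (p : G.Policy i), G.IsPolicy p →
    G.u πL i - G.entReg ε (πL i) πL ≥
      G.u (Function.update πL i p) i - G.entReg ε p πL

/-- Nash distribution with modification-R (parameter `ε`). -/
def NashDistR (ε : ℝ) (πR : G.JointPolicy) : Prop :=
  ∀ (i : Fin G.n) (p : G.Policy i), G.IsPolicy p →
    G.u πR i - G.entReg ε (πR i) (Function.update πR i p) ≥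
      G.u (Function.update πR i p) i - G.entReg ε p (Function.update πR i p)

end POSG

namespace POSG

lemma front_extend (G : POSG) {t : ℕ} (h : G.Hist t) (a : G.JointAct) (s' : G.S)
    (z' : G.ObsTuple) : G.front (G.extend h a s' z') = h := by
  simp [front, extend]

/-- Histories of length `t+1` as extensions. -/
def extEquiv (G : POSG) (t : ℕ) :
    (G.Hist t × G.JointAct × G.S × G.ObsTuple) ≃ G.Hist (t + 1) where
  toFun q := G.extend q.1 q.2.1 q.2.2.1 q.2.2.2
  invFun h := (G.front h, h.2.2 (Fin.last t), h.1 (Fin.last (t + 1)), h.2.1 (Fin.last (t + 1)))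
  left_inv q := by
    obtain ⟨h, a, s, z⟩ := q
    simp [front, extend]
  right_inv h := by
    obtain ⟨s, z, a⟩ := h
    simp only [front, extend]
    refine Prod.ext ?_ (Prod.ext ?_ ?_)
    · exact Fin.snoc_init_self s
    · exact Fin.snoc_init_self z
    · exact Fin.snoc_init_self a

lemma sum_hist_succ (G : POSG) (t : ℕ) (f : G.Hist (t + 1) → ℝ) :
    ∑ h, f h = ∑ h : G.Hist t, ∑ a : G.JointAct, ∑ s' : G.S, ∑ z' : G.ObsTuple,
      f (G.extend h a s' z') := by
  rw [← (G.extEquiv t).sum_comp f]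
  rw [Fintype.sum_prod_type]
  refine Finset.sum_congr rfl fun h _ => ?_
  rw [Fintype.sum_prod_type]
  refine Finset.sum_congr rfl fun a _ => ?_
  rw [Fintype.sum_prod_type]
  rfl

def zeroEquiv (G : POSG) : (G.S × G.ObsTuple) ≃ G.Hist 0 where
  toFun q := G.hist0 q.1 q.2
  invFun h := (h.1 0, h.2.1 0)
  left_inv q := by simp [hist0]
  right_inv h := by
    obtain ⟨s, z, a⟩ := h
    simp only [hist0]
    refine Prod.ext ?_ (Prod.ext ?_ ?_)
    · funext k; have hk : k = 0 := Fin.ext (by simp)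
      rw [hk]
    · funext k; have hk : k = 0 := Fin.ext (by simp)
      rw [hk]
    · funext k; exact k.elim0

lemma sum_hist_zero (G : POSG) (f : G.Hist 0 → ℝ) :
    ∑ h, f h = ∑ s, ∑ z, f (G.hist0 s z) := by
  rw [← (G.zeroEquiv).sum_comp f, Fintype.sum_prod_type]
  rfl

lemma histProb_extend (G : POSG) (π : G.JointPolicy) {t : ℕ} (h : G.Hist t) (a : G.JointAct)
    (s' : G.S) (z' : G.ObsTuple) :
    G.histProb π (t + 1) (G.extend h a s' z') =
      G.histProb π t h * G.polProb π h a * G.Tr (G.lastState h) a s' *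
        G.Obs (G.lastState h) a s' z' := by
  rw [histProb, front_extend]
  simp [lastState, extend]

lemma V_rec (G : POSG) (π : G.JointPolicy) (i : Fin G.n) {t : ℕ} (ht : t < G.T) (h : G.Hist t) :
    G.V π i h = ∑ a : G.JointAct, ∑ s' : G.S, ∑ z' : G.ObsTuple,
      G.polProb π h a * G.Tr (G.lastState h) a s' * G.Obs (G.lastState h) a s' z' *
        (G.R i (G.lastState h) a s' + G.γ * G.V π i (G.extend h a s' z')) := by
  unfold V
  obtain ⟨m, hm⟩ : ∃ m, G.T - t = m + 1 := ⟨G.T - t - 1, by omega⟩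
  have hm' : G.T - (t + 1) = m := by omega
  rw [hm, hm', valAux, if_pos ht]

lemma V_T (G : POSG) (π : G.JointPolicy) (i : Fin G.n) (h : G.Hist G.T) :
    G.V π i h = 0 := by
  unfold V
  rw [Nat.sub_self, valAux]

lemma polProb_update (G : POSG) (π : G.JointPolicy) (i : Fin G.n) (q : G.Policy i)
    {t : ℕ} (ht : t < G.T) (h : G.Hist t) (a : G.JointAct) :
    G.polProb (Function.update π i q) h a = q ⟨t, ht⟩ (G.red i h) (a i) *
      ∏ j ∈ Finset.univ.erase i, π j ⟨t, ht⟩ (G.red j h) (a j) := by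
  rw [polProb, dif_pos ht, ← Finset.mul_prod_erase Finset.univ _ (Finset.mem_univ i)]
  congr 1
  · simp
  · refine Finset.prod_congr rfl fun j hj => ?_
    rw [Function.update_of_ne (Finset.ne_of_mem_erase hj)]

lemma sum_Q (G : POSG) (π : G.JointPolicy) (i : Fin G.n) (q : G.Policy i)
    {t : ℕ} (ht : t < G.T) (h : G.Hist t) :
    ∑ b, q ⟨t, ht⟩ (G.red i h) b * G.Q π i h b =
      ∑ a : G.JointAct, ∑ s' : G.S, ∑ z' : G.ObsTuple,
      G.polProb (Function.update π i q) h a * G.Tr (G.lastState h) a s' *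
        G.Obs (G.lastState h) a s' z' *
        (G.R i (G.lastState h) a s' + G.γ * G.V π i (G.extend h a s' z')) := by
  simp only [Q, dif_pos ht, Finset.mul_sum]
  rw [Finset.sum_comm]
  refine Finset.sum_congr rfl fun a _ => ?_
  rw [Finset.sum_comm]
  refine Finset.sum_congr rfl fun s _ => ?_
  rw [Finset.sum_comm]
  refine Finset.sum_congr rfl fun z _ => ?_
  rw [Finset.sum_eq_single (a i)]
  · rw [if_pos rfl, polProb_update G π i q ht]; ring
  · intro b _ hb
    rw [if_neg (Ne.symm hb)]; ring
  · intro hh; exact absurd (Finset.mem_univ _) hh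

lemma sum_polProb (G : POSG) (π : G.JointPolicy) (hπ : G.IsJointPolicy π)
    {t : ℕ} (ht : t < G.T) (h : G.Hist t) : ∑ a, G.polProb π h a = 1 := by
  simp only [polProb, dif_pos ht]
  have := Finset.prod_univ_sum (fun _ : Fin G.n => (Finset.univ : Finset G.A))
    (fun j b => π j ⟨t, ht⟩ (G.red j h) b)
  rw [Fintype.piFinset_univ] at this
  rw [← this]
  exact Finset.prod_eq_one fun j _ => (hπ j).2 _ _

lemma sum_histProb (G : POSG) (π : G.JointPolicy) (hπ : G.IsJointPolicy π) :
    ∀ t, t ≤ G.T → ∑ h, G.histProb π t h = 1 := by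
  intro t
  induction t with
  | zero =>
    intro _
    rw [sum_hist_zero]
    simp only [histProb, hist0, ← Finset.mul_sum, G.O0_sum, mul_one, G.ρ_sum]
  | succ t ih =>
    intro ht
    rw [sum_hist_succ]
    simp only [histProb_extend, ← Finset.mul_sum, G.Obs_sum, mul_one, G.Tr_sum]
    rw [← ih (by omega)]
    refine Finset.sum_congr rfl fun h _ => ?_
    rw [sum_polProb G π hπ (by omega), mul_one]

lemma sum_pi_Adv (G : POSG) (π : G.JointPolicy) (hπ : G.IsJointPolicy π) (i : Fin G.n)
    {t : ℕ} (ht : t < G.T) (h : G.Hist t) :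
    ∑ b, π i ⟨t, ht⟩ (G.red i h) b * G.Adv π i h b = 0 := by
  simp only [Adv, mul_sub, Finset.sum_sub_distrib, ← Finset.sum_mul]
  rw [sum_Q G π i (π i) ht h, (hπ i).2, Function.update_eq_self, ← V_rec G π i ht, one_mul,
    sub_self]

/-- Expected advantage at a history. -/
def eAdv (G : POSG) (π : G.JointPolicy) (i : Fin G.n) (q : G.Policy i) (t : ℕ)
    (h : G.Hist t) : ℝ :=
  if ht : t < G.T then ∑ b, q ⟨t, ht⟩ (G.red i h) b * G.Adv π i h b else 0

def dGap (G : POSG) (π π' : G.JointPolicy) (i : Fin G.n) (t : ℕ) : ℝ :=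
  ∑ h, G.histProb π' t h * (G.V π' i h - G.V π i h)

lemma dGap_rec (G : POSG) (π : G.JointPolicy) (i : Fin G.n)
    (q : G.Policy i) (hq : G.IsPolicy q) {t : ℕ} (ht : t < G.T) :
    G.dGap π (Function.update π i q) i t =
      ∑ h, G.histProb (Function.update π i q) t h * G.eAdv π i q t h +
        G.γ * G.dGap π (Function.update π i q) i (t + 1) := by
  unfold dGap
  rw [sum_hist_succ, Finset.mul_sum, ← Finset.sum_add_distrib]
  refine Finset.sum_congr rfl fun h _ => ?_
  rw [eAdv, dif_pos ht]
  simp only [Adv, mul_sub (q _ _ _), Finset.sum_sub_distrib, ← Finset.sum_mul]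
  rw [sum_Q G π i q ht h, hq.2, V_rec G (Function.update π i q) i ht h]
  simp only [histProb_extend]
  set P := G.histProb (Function.update π i q) t h
  rw [one_mul, mul_sub, mul_sub, sub_add_eq_add_sub]
  congr 1
  simp only [Finset.mul_sum]
  simp only [← Finset.sum_add_distrib]
  refine Finset.sum_congr rfl fun a _ => Finset.sum_congr rfl fun s _ =>
    Finset.sum_congr rfl fun z _ => ?_
  ring

lemma u_diff (G : POSG) (π : G.JointPolicy) (i : Fin G.n)
    (q : G.Policy i) (hq : G.IsPolicy q) :
    G.u (Function.update π i q) i - G.u π i =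
      ∑ t ∈ Finset.range G.T, G.γ ^ t *
        ∑ h, G.histProb (Function.update π i q) t h * G.eAdv π i q t h := by
  have h0 : G.u (Function.update π i q) i - G.u π i = G.dGap π (Function.update π i q) i 0 := by
    unfold u dGap
    rw [sum_hist_zero]
    simp only [← Finset.sum_sub_distrib]
    refine Finset.sum_congr rfl fun s _ => Finset.sum_congr rfl fun z _ => ?_
    simp only [histProb, hist0]
    ring
  have key : ∀ k, k ≤ G.T → G.dGap π (Function.update π i q) i 0 =
      ∑ t ∈ Finset.range k, G.γ ^ t *
        ∑ h, G.histProb (Function.update π i q) t h * G.eAdv π i q t h +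
      G.γ ^ k * G.dGap π (Function.update π i q) i k := by
    intro k
    induction k with
    | zero => intro _; simp
    | succ k ih =>
      intro hk
      rw [ih (by omega), dGap_rec G π i q hq (by omega : k < G.T), Finset.sum_range_succ]
      ring
  rw [h0, key G.T le_rfl]
  have : G.dGap π (Function.update π i q) i G.T = 0 := by
    simp [dGap, V_T]
  rw [this]; ring

lemma continuous_histProb (G : POSG) (π : G.JointPolicy) (i : Fin G.n) (q : ℝ → G.Policy i)
    (hq : ∀ t x a, Continuous fun l => q l t x a) :
    ∀ t (h : G.Hist t), Continuous fun l => G.histProb (Function.update π i (q l)) t h := by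
  intro t
  induction t with
  | zero => intro h; simp only [histProb]; exact continuous_const
  | succ t ih =>
    intro h
    simp only [histProb]
    refine (((ih _).mul ?_).mul continuous_const).mul continuous_const
    by_cases ht : t < G.T
    · simp only [polProb_update G π i _ ht]
      exact (hq _ _ _).mul continuous_const
    · simp only [polProb, dif_neg ht]; exact continuous_const

/-- First order bound from concavity. -/
lemma first_order (G : POSG) (π : G.JointPolicy) (hπ : G.IsJointPolicy π) (i : Fin G.n)
    (p : G.Policy i) (hp : G.IsPolicy p)
    (hc : ConcaveOn ℝ {p : G.Policy i | G.IsPolicy p}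
        (fun p : G.Policy i => G.u (Function.update π i p) i)) :
    G.u (Function.update π i p) i - G.u π i ≤
      ∑ t ∈ Finset.range G.T, G.γ ^ t * ∑ h, G.histProb π t h * G.eAdv π i p t h := by
  let q : ℝ → G.Policy i := fun l => (1 - l) • π i + l • p
  let F : ℝ → ℝ := fun l => ∑ t ∈ Finset.range G.T, G.γ ^ t *
      ∑ h, G.histProb (Function.update π i (q l)) t h * G.eAdv π i p t h
  have hF : Continuous F := by
    refine continuous_finset_sum _ fun t _ => continuous_const.mul
      (continuous_finset_sum _ fun h _ => Continuous.mul ?_ continuous_const)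
    refine continuous_histProb G π i q ?_ t h
    intro t x a
    simp only [q, Pi.add_apply, Pi.smul_apply, smul_eq_mul]
    fun_prop
  have hF0 : F 0 = ∑ t ∈ Finset.range G.T, G.γ ^ t *
      ∑ h, G.histProb π t h * G.eAdv π i p t h := by
    simp [F, q]
  rw [← hF0]
  have hlim : Filter.Tendsto F (nhdsWithin 0 (Set.Ioi 0)) (nhds (F 0)) :=
    hF.continuousAt.tendsto.mono_left nhdsWithin_le_nhds
  refine ge_of_tendsto hlim ?_
  filter_upwards [Ioo_mem_nhdsGT (show (0 : ℝ) < 1 by norm_num)] with l hl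
  obtain ⟨hl0, hl1⟩ := hl
  have hmem : G.IsPolicy (q l) := hc.1 (hπ i) hp (by linarith) hl0.le (by ring)
  have h1 := hc.2 (hπ i) hp (by linarith : (0:ℝ) ≤ 1 - l) hl0.le (by ring)
  simp only [Function.update_eq_self, smul_eq_mul] at h1
  have h2 := u_diff G π i (q l) hmem
  have h3 : ∑ t ∈ Finset.range G.T, G.γ ^ t *
        ∑ h, G.histProb (Function.update π i (q l)) t h * G.eAdv π i (q l) t h = l * F l := by
    simp only [F, Finset.mul_sum]
    refine Finset.sum_congr rfl fun t ht => Finset.sum_congr rfl fun h _ => ?_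
    have ht' : t < G.T := Finset.mem_range.1 ht
    have : G.eAdv π i (q l) t h = l * G.eAdv π i p t h := by
      simp only [eAdv, dif_pos ht', q, Pi.add_apply, Pi.smul_apply, smul_eq_mul, add_mul,
        Finset.sum_add_distrib, mul_assoc, ← Finset.mul_sum]
      rw [sum_pi_Adv G π hπ i ht' h]; ring
    rw [this]; ring
  rw [h3] at h2
  have h4 : l * (G.u (Function.update π i p) i - G.u π i) ≤ l * F l := by
    have : (1 - l) * G.u π i + l * G.u (Function.update π i p) i ≤
      G.u (Function.update π i (q l)) i := h1
    linarith
  exact le_of_mul_le_mul_left h4 hl0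

lemma sum_eAdv (G : POSG) (π : G.JointPolicy) (i : Fin G.n) (p : G.Policy i) {t : ℕ}
    (ht : t < G.T) :
    ∑ h, G.histProb π t h * G.eAdv π i p t h =
      ∑ x : G.LocTraj i t, ∑ a, p ⟨t, ht⟩ x a * G.advW π i x a := by
  simp only [advW, Finset.mul_sum]
  simp_rw [fun x : G.LocTraj i t => Finset.sum_comm (s := (Finset.univ : Finset G.A))
    (t := (Finset.univ : Finset (G.Hist t)))
    (f := fun a h => p ⟨t, ht⟩ x a *
      if G.red i h = x then G.histProb π t h * G.Adv π i h a else 0)]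
  rw [Finset.sum_comm]
  refine Finset.sum_congr rfl fun h _ => ?_
  rw [Finset.sum_eq_single (G.red i h)]
  · rw [eAdv, dif_pos ht, Finset.mul_sum]
    refine Finset.sum_congr rfl fun a _ => ?_
    rw [if_pos rfl]; ring
  · intro x _ hx
    refine Finset.sum_eq_zero fun a _ => ?_
    rw [if_neg (Ne.symm hx), mul_zero]
  · intro hh; exact absurd (Finset.mem_univ _) hh

lemma sum_reach (G : POSG) (π : G.JointPolicy) (hπ : G.IsJointPolicy π) (i : Fin G.n) {t : ℕ}
    (ht : t < G.T) : ∑ x : G.LocTraj i t, G.reach π i x = 1 := by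
  simp only [reach]
  rw [Finset.sum_comm, ← sum_histProb G π hπ t ht.le]
  refine Finset.sum_congr rfl fun h _ => ?_
  rw [Finset.sum_ite_eq, if_pos (Finset.mem_univ _)]

lemma sum_pi_advW (G : POSG) (π : G.JointPolicy) (hπ : G.IsJointPolicy π) (i : Fin G.n) {t : ℕ}
    (ht : t < G.T) (x : G.LocTraj i t) :
    ∑ a, π i ⟨t, ht⟩ x a * G.advW π i x a = 0 := by
  simp only [advW, Finset.mul_sum]
  rw [Finset.sum_comm]
  refine Finset.sum_eq_zero fun h _ => ?_
  by_cases hx : G.red i h = x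
  · subst hx
    simp only [if_true]
    rw [← mul_zero (G.histProb π t h), ← sum_pi_Adv G π hπ i ht h, Finset.mul_sum]
    refine Finset.sum_congr rfl fun a _ => ?_
    ring
  · simp [if_neg hx]

end POSG

lemma softmax_pos {α : Type*} [Fintype α] (ε : ℝ) (y : α → ℝ) (a : α) :
    0 < softmax ε y a := by
  haveI : Nonempty α := ⟨a⟩
  exact div_pos (Real.exp_pos _)
    (Finset.sum_pos (fun b _ => Real.exp_pos _) Finset.univ_nonempty)

lemma softmax_sum {α : Type*} [Fintype α] [Nonempty α] (ε : ℝ) (y : α → ℝ) :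
    ∑ a, softmax ε y a = 1 := by
  simp only [softmax, ← Finset.sum_div]
  exact div_self (Finset.sum_pos (fun b _ => Real.exp_pos _) Finset.univ_nonempty).ne'

lemma softmax_bound {α : Type*} [Fintype α] (ε : ℝ) (hε : 0 < ε) (y : α → ℝ)
    (h : ∑ a, softmax ε y a * y a = 0) (a : α) : y a ≤ ε * Real.log (Fintype.card α) := by
  haveI : Nonempty α := ⟨a⟩
  have hZ : 0 < ∑ b, Real.exp (y b / ε) :=
    Finset.sum_pos (fun b _ => Real.exp_pos _) Finset.univ_nonempty
  have h0 : ∑ b, Real.exp (y b / ε) * (y b / ε) = 0 := by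
    have : ∑ b, Real.exp (y b / ε) * (y b / ε) =
        (∑ b, Real.exp (y b / ε)) / ε * ∑ b, softmax ε y b * y b := by
      rw [Finset.mul_sum]
      refine Finset.sum_congr rfl fun b _ => ?_
      unfold softmax
      field_simp
    rw [this, h, mul_zero]
  have h1 : ∑ b, Real.exp (y b / ε) ≤ Fintype.card α := by
    have : ∑ b, (Real.exp (y b / ε) - Real.exp (y b / ε) * (y b / ε)) ≤ ∑ _b : α, (1 : ℝ) := by
      refine Finset.sum_le_sum fun b _ => ?_
      have e1 := Real.add_one_le_exp (-(y b / ε))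
      have e2 : Real.exp (y b / ε) * Real.exp (-(y b / ε)) = 1 := by
        rw [← Real.exp_add]; simp
      nlinarith [Real.exp_pos (y b / ε)]
    rw [Finset.sum_sub_distrib, h0] at this
    simpa using this
  have h2 : Real.exp (y a / ε) ≤ Fintype.card α :=
    (Finset.single_le_sum (f := fun b => Real.exp (y b / ε))
      (fun b _ => (Real.exp_pos _).le) (Finset.mem_univ a)).trans h1
  have h3 : y a / ε ≤ Real.log (Fintype.card α) :=
    (Real.le_log_iff_exp_le ((Real.exp_pos _).trans_le h2)).2 h2
  rw [div_le_iff₀ hε] at h3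
  linarith

/-- **Theorem 2 (deviation bound for IESL rest points).**  If every individual utility
`π^i ↦ u^i(π^i, π̄^{-i})` is concave on the set of policies, then every rest point
`ȳ_ε` of the IESL dynamic (i.e. `w(σ(ȳ_ε)) = ȳ_ε`) induces the policy
`π̄_ε = σ(ȳ_ε)`, which is an `ε'`-Nash equilibrium with
`ε' = ε · log|A| · ∑_{k=0}^{T-1} γ^k`. -/
theorem iesl_rest_point_is_approx_nash (G : POSG) (hreach : G.ReachPos)
    (hconc : ∀ (i : Fin G.n) (π : G.JointPolicy), G.IsJointPolicy π →
      ConcaveOn ℝ {p : G.Policy i | G.IsPolicy p}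
        (fun p : G.Policy i => G.u (Function.update π i p) i))
    (ε : ℝ) (hε : 0 < ε)
    (yε : G.Score) (hrest : G.w (G.choice ε yε) = yε) :
    ∀ (i : Fin G.n) (p : G.Policy i), G.IsPolicy p →
      G.u (Function.update (G.choice ε yε) i p) i - G.u (G.choice ε yε) i ≤
        ε * Real.log (Fintype.card G.A) * ∑ k ∈ Finset.range G.T, G.γ ^ k := by
  intro i p hp
  set π := G.choice ε yε with hπdef
  have hπ : G.IsJointPolicy π := fun j =>
    ⟨fun t x a => (softmax_pos ε (yε j t x) a).le, fun t x => softmax_sum ε (yε j t x)⟩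
  have hmix : G.FullyMixed π := fun j t x a => softmax_pos ε (yε j t x) a
  refine (POSG.first_order G π hπ i p hp (hconc i π hπ)).trans ?_
  rw [Finset.mul_sum]
  refine Finset.sum_le_sum fun t ht => ?_
  have ht' : t < G.T := Finset.mem_range.1 ht
  rw [mul_comm]
  refine mul_le_mul_of_nonneg_right ?_ (pow_nonneg G.γ_pos.le _)
  rw [POSG.sum_eAdv G π i p ht']
  have hx : ∀ x : G.LocTraj i t, ∑ a, p ⟨t, ht'⟩ x a * G.advW π i x a ≤
      ε * Real.log (Fintype.card G.A) * G.reach π i x := by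
    intro x
    have hr : 0 < G.reach π i x := hreach π hπ hmix i ⟨t, ht'⟩ x
    have hy : ∀ a, G.advW π i x a = yε i ⟨t, ht'⟩ x a * G.reach π i x := by
      intro a
      have e : G.w π i ⟨t, ht'⟩ x a = yε i ⟨t, ht'⟩ x a := by rw [hrest]
      have e' : G.advW π i x a / G.reach π i x = yε i ⟨t, ht'⟩ x a := e
      rw [← e', div_mul_cancel₀ _ hr.ne']
    have hz : ∑ a, softmax ε (yε i ⟨t, ht'⟩ x) a * yε i ⟨t, ht'⟩ x a = 0 := by
      have h1 := POSG.sum_pi_advW G π hπ i ht' x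
      simp only [hy, ← mul_assoc, ← Finset.sum_mul] at h1
      exact (mul_eq_zero.1 h1).resolve_right hr.ne'
    have hb := softmax_bound ε hε _ hz
    calc ∑ a, p ⟨t, ht'⟩ x a * G.advW π i x a
        ≤ ∑ a, p ⟨t, ht'⟩ x a * (ε * Real.log (Fintype.card G.A) * G.reach π i x) := by
          refine Finset.sum_le_sum fun a _ => mul_le_mul_of_nonneg_left ?_ (hp.1 _ _ _)
          rw [hy]
          exact mul_le_mul_of_nonneg_right (hb a) hr.le
      _ = ε * Real.log (Fintype.card G.A) * G.reach π i x := by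
          rw [← Finset.sum_mul, hp.2, one_mul]
  refine (Finset.sum_le_sum fun x _ => hx x).trans ?_
  rw [← Finset.mul_sum, POSG.sum_reach G π hπ i ht', mul_one]
end
end

section
/- Theorem 3 (convergence of IESL under local hypomonotonicity): Fix ε > 0 and η > 0. Let ȳ_ε be a rest point of IESL (w(σ(ȳ_ε)) = ȳ_ε) contained in a compact set Ω of scores that is positively invariant for the dynamic ẏ = η(w(σ(y)) − y), let Π_local = {σ(ȳ) : ȳ ∈ Ω}, and suppose the game is locally μ-hypomonotone about π̄_ε = σ(ȳ_ε) on Π_local with μ < ε. Then for every differentiable solution y : [0,∞) → score space of ẏ(t) = η(w(σ(y(t))) − y(t)) with y(0) ∈ Ω, the policy σ(y(t)) converges to π̄_ε as t → ∞. -/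
open scoped Classical BigOperators

noncomputable section

lemma aux_kl_elem (p q : ℝ) (hp : 0 < p) (hp1 : p ≤ 1) (hq : 0 < q) (hq1 : q ≤ 1) :
    (p - q) + (p - q) ^ 2 / 2 ≤ p * (Real.log p - Real.log q) := by
  rcases le_total q p with h | h
  · have h1 := Real.le_log_one_add_of_nonneg (x := (p - q) / q) (div_nonneg (by linarith) hq.le)
    have e1 : 1 + (p - q) / q = p / q := by field_simp; ring
    rw [e1, Real.log_div hp.ne' hq.ne'] at h1
    have e2 : 2 * ((p - q) / q) / ((p - q) / q + 2) = 2 * (p - q) / (p + q) := by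
      have : (p - q) / q + 2 = (p + q) / q := by field_simp; ring
      rw [this]; field_simp
    rw [e2] at h1
    have h2 := mul_le_mul_of_nonneg_left h1 hp.le
    refine le_trans ?_ h2
    have e3 : p * (2 * (p - q) / (p + q)) = (p - q) + (p - q) ^ 2 / (p + q) := by
      field_simp; ring
    rw [e3]
    have : (p - q) ^ 2 / 2 ≤ (p - q) ^ 2 / (p + q) :=
      div_le_div_of_nonneg_left (sq_nonneg _) (by linarith) (by linarith)
    linarith
  · have hx : 1 ≤ q / p := by rw [le_div_iff₀ hp]; linarith
    have h1 := Real.self_le_sinh_iff.2 (Real.log_nonneg hx)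
    rw [Real.sinh_log (by positivity), Real.log_div hq.ne' hp.ne'] at h1
    have h2 := mul_le_mul_of_nonneg_left h1 hp.le
    have e3 : p * ((q / p - (q / p)⁻¹) / 2) = (q - p) - (p - q) ^ 2 / (2 * q) := by
      field_simp; ring
    rw [e3] at h2
    have : (p - q) ^ 2 / 2 ≤ (p - q) ^ 2 / (2 * q) :=
      div_le_div_of_nonneg_left (sq_nonneg _) (by linarith) (by linarith)
    nlinarith

section aux
variable {α : Type*} [Fintype α] [Nonempty α]

lemma aux_Z_pos (ε : ℝ) (y : α → ℝ) : 0 < ∑ b, Real.exp (y b / ε) :=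
  Finset.sum_pos (fun _ _ => Real.exp_pos _) Finset.univ_nonempty

lemma aux_sm_pos (ε : ℝ) (y : α → ℝ) (a : α) : 0 < softmax ε y a :=
  div_pos (Real.exp_pos _) (aux_Z_pos ε y)

lemma aux_sm_sum (ε : ℝ) (y : α → ℝ) : ∑ a, softmax ε y a = 1 := by
  unfold softmax
  rw [← Finset.sum_div, div_self (aux_Z_pos ε y).ne']

lemma aux_sm_le (ε : ℝ) (y : α → ℝ) (a : α) : softmax ε y a ≤ 1 := by
  rw [← aux_sm_sum ε y]
  exact Finset.single_le_sum (f := softmax ε y) (fun b _ => (aux_sm_pos ε y b).le)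
    (Finset.mem_univ a)

def auxPhi (ε : ℝ) (y : α → ℝ) : ℝ := ε * Real.log (∑ b, Real.exp (y b / ε))

def auxD (ε : ℝ) (y y0 : α → ℝ) : ℝ :=
  auxPhi ε y - auxPhi ε y0 - ∑ a, softmax ε y0 a * (y a - y0 a)

lemma aux_log_sm (ε : ℝ) (hε : 0 < ε) (y : α → ℝ) (a : α) :
    ε * Real.log (softmax ε y a) = y a - auxPhi ε y := by
  unfold softmax auxPhi
  rw [Real.log_div (Real.exp_pos _).ne' (aux_Z_pos ε y).ne', Real.log_exp]
  field_simp

lemma auxD_eq (ε : ℝ) (hε : 0 < ε) (y y0 : α → ℝ) :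
    auxD ε y y0 = ε * ∑ a, softmax ε y0 a *
      (Real.log (softmax ε y0 a) - Real.log (softmax ε y a)) := by
  have h : ∀ a, ε * (softmax ε y0 a *
      (Real.log (softmax ε y0 a) - Real.log (softmax ε y a))) =
      softmax ε y0 a * (auxPhi ε y - auxPhi ε y0) - softmax ε y0 a * (y a - y0 a) := by
    intro a
    have h1 := aux_log_sm ε hε y a
    have h2 := aux_log_sm ε hε y0 a
    linear_combination softmax ε y0 a * h2 - softmax ε y0 a * h1
  rw [Finset.mul_sum, Finset.sum_congr rfl (fun a _ => h a), Finset.sum_sub_distrib,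
    ← Finset.sum_mul, aux_sm_sum, auxD]
  ring

lemma auxD_ge (ε : ℝ) (hε : 0 < ε) (y y0 : α → ℝ) :
    ε / 2 * ∑ a, (softmax ε y a - softmax ε y0 a) ^ 2 ≤ auxD ε y y0 := by
  rw [auxD_eq ε hε]
  have h : ∑ a, ((softmax ε y0 a - softmax ε y a)
      + (softmax ε y0 a - softmax ε y a) ^ 2 / 2) ≤ ∑ a, softmax ε y0 a *
      (Real.log (softmax ε y0 a) - Real.log (softmax ε y a)) :=
    Finset.sum_le_sum fun a _ => aux_kl_elem _ _ (aux_sm_pos ε y0 a) (aux_sm_le ε y0 a)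
      (aux_sm_pos ε y a) (aux_sm_le ε y a)
  rw [Finset.sum_add_distrib, Finset.sum_sub_distrib, aux_sm_sum, aux_sm_sum,
    ← Finset.sum_div] at h
  have e : ∑ a, (softmax ε y a - softmax ε y0 a) ^ 2 =
      ∑ a, (softmax ε y0 a - softmax ε y a) ^ 2 :=
    Finset.sum_congr rfl fun a _ => by ring
  rw [e]
  have := mul_le_mul_of_nonneg_left h hε.le
  linarith

lemma auxD_nonneg (ε : ℝ) (hε : 0 < ε) (y y0 : α → ℝ) : 0 ≤ auxD ε y y0 :=
  le_trans (mul_nonneg (by positivity) (Finset.sum_nonneg fun _ _ => sq_nonneg _))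
    (auxD_ge ε hε y y0)

lemma auxD_symm (ε : ℝ) (y y0 : α → ℝ) :
    auxD ε y y0 + auxD ε y0 y =
      ∑ a, (softmax ε y a - softmax ε y0 a) * (y a - y0 a) := by
  unfold auxD
  have : ∑ a, (softmax ε y a - softmax ε y0 a) * (y a - y0 a) =
      - ∑ a, softmax ε y a * (y0 a - y a) - ∑ a, softmax ε y0 a * (y a - y0 a) := by
    rw [← Finset.sum_neg_distrib, ← Finset.sum_sub_distrib]
    exact Finset.sum_congr rfl fun a _ => by ring
  rw [this]; ring

lemma auxD_deriv (ε : ℝ) (hε : 0 < ε) (y : ℝ → α → ℝ) (y0 v : α → ℝ) (t : ℝ)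
    (hy : ∀ a, HasDerivAt (fun s => y s a) (v a) t) :
    HasDerivAt (fun s => auxD ε (y s) y0)
      (∑ a, (softmax ε (y t) a - softmax ε y0 a) * v a) t := by
  have h1 : HasDerivAt (fun s => ∑ b, Real.exp (y s b / ε))
      (∑ b, Real.exp (y t b / ε) * (v b / ε)) t :=
    HasDerivAt.fun_sum fun b _ => ((hy b).div_const ε).exp
  have h2 := ((h1.log (aux_Z_pos ε (y t)).ne').const_mul ε).sub_const (auxPhi ε y0)
  have h3 : HasDerivAt (fun s => ∑ a, softmax ε y0 a * (y s a - y0 a))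
      (∑ a, softmax ε y0 a * v a) t :=
    HasDerivAt.fun_sum fun b _ => ((hy b).sub_const (y0 b)).const_mul _
  refine (h2.sub h3).congr_deriv ?_
  rw [Finset.sum_div, Finset.mul_sum, ← Finset.sum_sub_distrib]
  refine Finset.sum_congr rfl fun a _ => ?_
  have := (aux_Z_pos ε (y t)).ne'
  unfold softmax
  field_simp

end aux

/-- **Theorem 3 (convergence of IESL under local hypomonotonicity).**  Let `ȳ_ε` be a
rest point of IESL contained in a compact, positively invariant set `Ω` of scores, and
suppose the game is locally `μ`-hypomonotone about `π̄_ε = σ(ȳ_ε)` on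
`Π_local = σ(Ω)` with `μ < ε`.  Then along every solution of
`ẏ = η (w(σ(y)) − y)` started in `Ω`, the policy `σ(y(t))` converges to `π̄_ε`. -/
theorem iesl_convergence (G : POSG) (hreach : G.ReachPos)
    (ε η : ℝ) (hε : 0 < ε) (hη : 0 < η)
    (yε : G.Score) (hrest : G.w (G.choice ε yε) = yε)
    (Ω : Set G.Score) (hΩ : IsCompact Ω) (hyεΩ : yε ∈ Ω)
    (hinv : ∀ y : ℝ → G.Score,
      (∀ t : ℝ, 0 ≤ t → HasDerivAt y (η • (G.w (G.choice ε (y t)) - y t)) t) →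
        y 0 ∈ Ω → ∀ t : ℝ, 0 ≤ t → y t ∈ Ω)
    (μ : ℝ) (hμ0 : 0 ≤ μ) (hμε : μ < ε)
    (hhypo : ∀ π ∈ (fun yΩ : G.Score => G.choice ε yΩ) '' Ω,
      ∑ i : Fin G.n, ∑ t : Fin G.T, ∑ x : G.LocTraj i t.1, ∑ a : G.A,
          (π i t x a - G.choice ε yε i t x a) *
            (G.w π i t x a - G.w (G.choice ε yε) i t x a) ≤
        μ * ∑ i : Fin G.n, ∑ t : Fin G.T, ∑ x : G.LocTraj i t.1, ∑ a : G.A,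
          (π i t x a - G.choice ε yε i t x a) ^ 2)
    (y : ℝ → G.Score)
    (hy : ∀ t : ℝ, 0 ≤ t → HasDerivAt y (η • (G.w (G.choice ε (y t)) - y t)) t)
    (hy0 : y 0 ∈ Ω) :
    Filter.Tendsto (fun t : ℝ => G.choice ε (y t)) Filter.atTop
      (nhds (G.choice ε yε)) := by
  have hyΩ := hinv y hy hy0
  set c : ℝ := η * (1 - μ / ε) with hc
  have hc0 : 0 < c := mul_pos hη (by rw [sub_pos, div_lt_one hε]; exact hμε)
  let L : ℝ → ℝ := fun s => ∑ i : Fin G.n, ∑ t : Fin G.T, ∑ x : G.LocTraj i t.1,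
    auxD ε (y s i t x) (yε i t x)
  have hL : ∀ s, 0 ≤ s → HasDerivAt L (∑ i : Fin G.n, ∑ t : Fin G.T, ∑ x : G.LocTraj i t.1,
      ∑ a, (softmax ε (y s i t x) a - softmax ε (yε i t x) a) *
        (η * (G.w (G.choice ε (y s)) i t x a - y s i t x a))) s := by
    intro s hs
    refine HasDerivAt.fun_sum fun i _ => HasDerivAt.fun_sum fun t _ =>
      HasDerivAt.fun_sum fun x _ => ?_
    refine auxD_deriv ε hε (fun s => y s i t x) (yε i t x) _ s fun a => ?_
    have h := hy s hs
    rw [hasDerivAt_pi] at h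
    have h := h i
    rw [hasDerivAt_pi] at h
    have h := h t
    rw [hasDerivAt_pi] at h
    have h := h x
    rw [hasDerivAt_pi] at h
    exact h a
  have hLnn : ∀ s, 0 ≤ L s := fun s => Finset.sum_nonneg fun i _ => Finset.sum_nonneg fun t _ =>
    Finset.sum_nonneg fun x _ => auxD_nonneg ε hε _ _
  have hbound : ∀ s, 0 ≤ s → (∑ i : Fin G.n, ∑ t : Fin G.T, ∑ x : G.LocTraj i t.1,
      ∑ a, (softmax ε (y s i t x) a - softmax ε (yε i t x) a) *
        (η * (G.w (G.choice ε (y s)) i t x a - y s i t x a))) ≤ - c * L s := by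
    intro s hs
    have hh := hhypo _ ⟨y s, hyΩ s hs, rfl⟩
    rw [hrest] at hh
    simp only [POSG.choice] at hh
    -- sum of the reversed divergences
    let L' : ℝ := ∑ i : Fin G.n, ∑ t : Fin G.T, ∑ x : G.LocTraj i t.1,
      auxD ε (yε i t x) (y s i t x)
    have hL'nn : 0 ≤ L' := Finset.sum_nonneg fun i _ => Finset.sum_nonneg fun t _ =>
      Finset.sum_nonneg fun x _ => auxD_nonneg ε hε _ _
    let N : ℝ := ∑ i : Fin G.n, ∑ t : Fin G.T, ∑ x : G.LocTraj i t.1, ∑ a : G.A,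
      (softmax ε (y s i t x) a - softmax ε (yε i t x) a) ^ 2
    have hN1 : ε / 2 * N ≤ L s := by
      simp only [N, L, Finset.mul_sum]
      refine Finset.sum_le_sum fun i _ => Finset.sum_le_sum fun t _ =>
        Finset.sum_le_sum fun x _ => ?_
      have := auxD_ge ε hε (y s i t x) (yε i t x)
      rwa [Finset.mul_sum] at this
    have hN2 : ε / 2 * N ≤ L' := by
      simp only [N, L', Finset.mul_sum]
      refine Finset.sum_le_sum fun i _ => Finset.sum_le_sum fun t _ =>
        Finset.sum_le_sum fun x _ => ?_
      have := auxD_ge ε hε (yε i t x) (y s i t x)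
      rw [Finset.mul_sum] at this
      refine le_trans (le_of_eq (Finset.sum_congr rfl fun a _ => by ring)) this
    have hsym : L s + L' = ∑ i : Fin G.n, ∑ t : Fin G.T, ∑ x : G.LocTraj i t.1, ∑ a : G.A,
        (softmax ε (y s i t x) a - softmax ε (yε i t x) a) * (y s i t x a - yε i t x a) := by
      simp only [L, L', ← Finset.sum_add_distrib, auxD_symm]
    have hdec : (∑ i : Fin G.n, ∑ t : Fin G.T, ∑ x : G.LocTraj i t.1,
      ∑ a, (softmax ε (y s i t x) a - softmax ε (yε i t x) a) *
        (η * (G.w (G.choice ε (y s)) i t x a - y s i t x a))) =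
        η * (∑ i : Fin G.n, ∑ t : Fin G.T, ∑ x : G.LocTraj i t.1, ∑ a : G.A,
          (softmax ε (y s i t x) a - softmax ε (yε i t x) a) *
            (G.w (G.choice ε (y s)) i t x a - yε i t x a)) - η * (L s + L') := by
      rw [hsym]
      simp only [Finset.mul_sum, ← Finset.sum_sub_distrib]
      refine Finset.sum_congr rfl fun i _ => Finset.sum_congr rfl fun t _ =>
        Finset.sum_congr rfl fun x _ => Finset.sum_congr rfl fun a _ => by ring
    rw [hdec]
    have h1 := mul_le_mul_of_nonneg_left hh hη.le
    have h2 : μ * N ≤ μ / ε * (L s + L') := by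
      have : ε * N ≤ L s + L' := by linarith
      have h3 := mul_le_mul_of_nonneg_left this (div_nonneg hμ0 hε.le)
      rw [← mul_assoc, div_mul_cancel₀ _ hε.ne'] at h3
      exact h3
    have h3 := mul_le_mul_of_nonneg_left h2 hη.le
    have h4 : 0 ≤ c * L' := mul_nonneg hc0.le hL'nn
    refine le_trans (sub_le_sub_right (h1.trans h3) _) ?_
    rw [hc] at h4 ⊢
    linarith
  have hanti : AntitoneOn (fun s => L s * Real.exp (c * s)) (Set.Ici 0) := by
    have hd : ∀ s, 0 ≤ s → HasDerivAt (fun s => L s * Real.exp (c * s)) _ s := fun s hs =>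
      (hL s hs).mul (((hasDerivAt_id s).const_mul c).exp)
    refine antitoneOn_of_deriv_nonpos (convex_Ici 0)
      (fun s hs => (hd s hs).continuousAt.continuousWithinAt) ?_ ?_
    · intro s hs
      rw [interior_Ici] at hs
      exact (hd s (le_of_lt hs)).differentiableAt.differentiableWithinAt
    · intro s hs
      rw [interior_Ici] at hs
      have hs' : 0 ≤ s := le_of_lt hs
      rw [(hd s hs').deriv]
      have := mul_le_mul_of_nonneg_right (hbound s hs') (Real.exp_pos (c * s)).le
      simp only [id, mul_one]
      linarith
  have hLle : ∀ s, 0 ≤ s → L s ≤ L 0 * Real.exp (-(c * s)) := by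
    intro s hs
    have h := hanti (Set.mem_Ici.2 le_rfl) (Set.mem_Ici.2 hs) hs
    simp only [mul_zero, Real.exp_zero, mul_one] at h
    rw [Real.exp_neg, ← div_eq_mul_inv, le_div_iff₀ (Real.exp_pos _)]
    exact h
  have hL0 : Filter.Tendsto L Filter.atTop (nhds 0) := by
    have he : Filter.Tendsto (fun s : ℝ => L 0 * Real.exp (-(c * s))) Filter.atTop (nhds 0) := by
      have := (Real.tendsto_exp_neg_atTop_nhds_zero.comp
        (Filter.tendsto_id.const_mul_atTop hc0)).const_mul (L 0)
      simpa using this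
    refine tendsto_of_tendsto_of_tendsto_of_le_of_le' tendsto_const_nhds he
      (Filter.Eventually.of_forall hLnn) ?_
    filter_upwards [Filter.eventually_ge_atTop 0] with s hs using hLle s hs
  rw [tendsto_pi_nhds]; intro i
  rw [tendsto_pi_nhds]; intro t
  rw [tendsto_pi_nhds]; intro x
  rw [tendsto_pi_nhds]; intro a
  have hsq : ∀ s, (G.choice ε (y s) i t x a - G.choice ε yε i t x a) ^ 2 ≤ 2 / ε * L s := by
    intro s
    have h1 : (G.choice ε (y s) i t x a - G.choice ε yε i t x a) ^ 2 ≤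
        ∑ a, (softmax ε (y s i t x) a - softmax ε (yε i t x) a) ^ 2 :=
      Finset.single_le_sum (f := fun a => (softmax ε (y s i t x) a - softmax ε (yε i t x) a) ^ 2)
        (fun _ _ => sq_nonneg _) (Finset.mem_univ a)
    have h2 := auxD_ge ε hε (y s i t x) (yε i t x)
    have h3 : auxD ε (y s i t x) (yε i t x) ≤ L s := by
      refine le_trans ?_ (Finset.single_le_sum (f := fun i => ∑ t : Fin G.T,
        ∑ x : G.LocTraj i t.1, auxD ε (y s i t x) (yε i t x)) (fun i _ =>
        Finset.sum_nonneg fun t _ => Finset.sum_nonneg fun x _ => auxD_nonneg ε hε _ _)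
        (Finset.mem_univ i))
      refine le_trans ?_ (Finset.single_le_sum (f := fun t : Fin G.T =>
        ∑ x : G.LocTraj i t.1, auxD ε (y s i t x) (yε i t x)) (fun t _ =>
        Finset.sum_nonneg fun x _ => auxD_nonneg ε hε _ _) (Finset.mem_univ t))
      exact Finset.single_le_sum (f := fun x : G.LocTraj i t.1 =>
        auxD ε (y s i t x) (yε i t x)) (fun x _ => auxD_nonneg ε hε _ _) (Finset.mem_univ x)
    have h4 := (mul_le_mul_of_nonneg_left h1 (by positivity : 0 ≤ ε / 2)).trans (h2.trans h3)
    have h5 := mul_le_mul_of_nonneg_left h4 (by positivity : 0 ≤ 2 / ε)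
    rwa [← mul_assoc, show 2 / ε * (ε / 2) = 1 by field_simp, one_mul] at h5
  have hz : Filter.Tendsto (fun s => (G.choice ε (y s) i t x a - G.choice ε yε i t x a) ^ 2)
      Filter.atTop (nhds 0) := by
    refine squeeze_zero (fun s => sq_nonneg _) hsq ?_
    simpa using hL0.const_mul (2 / ε)
  have hz2 := hz.sqrt
  simp only [Real.sqrt_sq_eq_abs, Real.sqrt_zero] at hz2
  exact tendsto_sub_nhds_zero_iff.1 ((tendsto_zero_iff_abs_tendsto_zero _).2 hz2)
end
end

section
/- Deviation bound for modification-L Nash distributions: Fix ε ≥ 0. Every Nash distribution π̄_L with modification-L with parameter ε is an ε′-Nash equilibrium with ε′ = ε · log|A| · Σ_{k=0}^{T−1} γ^k; that is, for every player i and every π^i ∈ Π^i, u^i(π^i, π̄_L^{−i}) − u^i(π̄_L) ≤ ε · log|A| · Σ_{k=0}^{T−1} γ^k. -/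
open scoped Classical BigOperators

noncomputable section

theorem aux_negEnt_nonpos {α : Type*} [Fintype α] (p : α → ℝ) (h0 : ∀ a, 0 ≤ p a)
    (h1 : ∑ a, p a = 1) : negEnt p ≤ 0 := by
  unfold negEnt
  apply Finset.sum_nonpos
  intro a _
  have hle : p a ≤ 1 := by
    rw [← h1]
    exact Finset.single_le_sum (fun b _ => h0 b) (Finset.mem_univ a)
  exact mul_nonpos_of_nonneg_of_nonpos (h0 a) (Real.log_nonpos (h0 a) hle)

theorem aux_negEnt_lower {α : Type*} [Fintype α] [Nonempty α] (p : α → ℝ) (h0 : ∀ a, 0 ≤ p a)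
    (h1 : ∑ a, p a = 1) : -Real.log (Fintype.card α) ≤ negEnt p := by
  have hn : (0 : ℝ) < Fintype.card α := by exact_mod_cast Fintype.card_pos
  have key : ∀ a, p a - 1 / (Fintype.card α : ℝ) ≤
      p a * Real.log (p a) + p a * Real.log (Fintype.card α) := by
    intro a
    rcases (h0 a).eq_or_lt with h | h
    · rw [← h]; simp
    · have hl := Real.log_le_sub_one_of_pos (x := 1 / (Fintype.card α * p a)) (by positivity)
      rw [one_div, Real.log_inv, Real.log_mul hn.ne' h.ne'] at hl
      have h2 := mul_le_mul_of_nonneg_left hl h.le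
      have h3 : p a * ((Fintype.card α * p a)⁻¹ - 1) = 1 / (Fintype.card α : ℝ) - p a := by
        field_simp
      rw [h3] at h2
      linarith
  have hs := Finset.sum_le_sum (fun a (_ : a ∈ Finset.univ) => key a)
  rw [Finset.sum_sub_distrib, Finset.sum_add_distrib, ← Finset.sum_mul, h1] at hs
  have h4 : ∑ _a : α, 1 / (Fintype.card α : ℝ) = 1 := by
    simp [hn.ne']
  rw [h4] at hs
  unfold negEnt
  linarith

theorem aux_polProb_sum (G : POSG) (π : G.JointPolicy) (hπ : G.IsJointPolicy π) {t : ℕ}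
    (ht : t < G.T) (h : G.Hist t) : ∑ a, G.polProb π h a = 1 := by
  unfold POSG.polProb
  simp only [ht, dif_pos]
  have := Fintype.prod_sum (fun (i : Fin G.n) (a : G.A) => π i ⟨t, ht⟩ (G.red i h) a)
  rw [← this]
  exact Finset.prod_eq_one fun i _ => (hπ i).2 _ _

theorem aux_histProb_nonneg (G : POSG) (π : G.JointPolicy) (hπ : G.IsJointPolicy π) :
    ∀ (t : ℕ) (h : G.Hist t), 0 ≤ G.histProb π t h := by
  intro t
  induction t with
  | zero => intro h; exact mul_nonneg (G.ρ_nonneg _) (G.O0_nonneg _ _)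
  | succ t ih =>
    intro h
    refine mul_nonneg (mul_nonneg (mul_nonneg (ih _) ?_) (G.Tr_nonneg _ _ _)) (G.Obs_nonneg _ _ _ _)
    unfold POSG.polProb
    split_ifs
    · exact Finset.prod_nonneg fun i _ => (hπ i).1 _ _ _
    · exact le_rfl

def auxEquiv (G : POSG) (t : ℕ) :
    (G.Hist t × G.JointAct × G.S × G.ObsTuple) ≃ G.Hist (t + 1) where
  toFun q := G.extend q.1 q.2.1 q.2.2.1 q.2.2.2
  invFun h := (G.front h, h.2.2 (Fin.last t), h.1 (Fin.last (t + 1)), h.2.1 (Fin.last (t + 1)))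
  left_inv := by
    rintro ⟨⟨a, b, c⟩, d, e, f⟩
    simp [POSG.front, POSG.extend]
  right_inv := by
    rintro ⟨a, b, c⟩
    simp only [POSG.front, POSG.extend]
    refine Prod.ext ?_ (Prod.ext ?_ ?_)
    · exact Fin.snoc_init_self a
    · exact Fin.snoc_init_self b
    · exact Fin.snoc_init_self c

theorem aux_histProb_extend (G : POSG) (π : G.JointPolicy) {t : ℕ} (h : G.Hist t)
    (a : G.JointAct) (s : G.S) (z : G.ObsTuple) :
    G.histProb π (t + 1) (G.extend h a s z) =
      G.histProb π t h * G.polProb π h a * G.Tr (G.lastState h) a s *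
        G.Obs (G.lastState h) a s z := by
  have hf : G.front (G.extend h a s z) = h := by
    obtain ⟨b, c, d⟩ := h
    simp [POSG.front, POSG.extend]
  rw [POSG.histProb, hf]
  simp [POSG.extend, POSG.lastState]

theorem aux_histProb_sum (G : POSG) (π : G.JointPolicy) (hπ : G.IsJointPolicy π) :
    ∀ (t : ℕ), t ≤ G.T → ∑ h : G.Hist t, G.histProb π t h = 1 := by
  intro t
  induction t with
  | zero =>
    intro _
    let e : (G.S × G.ObsTuple) ≃ G.Hist 0 :=
      { toFun := fun q => G.hist0 q.1 q.2
        invFun := fun h => (h.1 0, h.2.1 0)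
        left_inv := fun q => rfl
        right_inv := by
          rintro ⟨a, b, c⟩
          refine Prod.ext ?_ (Prod.ext ?_ ?_)
          · funext k; obtain rfl : k = 0 := Fin.ext (by omega)
            rfl
          · funext k; obtain rfl : k = 0 := Fin.ext (by omega)
            rfl
          · funext k; exact k.elim0 }
    rw [← e.sum_comp, Fintype.sum_prod_type]
    change ∑ s, ∑ z, G.ρ s * G.O0 s z = 1
    simp_rw [← Finset.mul_sum, G.O0_sum, mul_one]
    exact G.ρ_sum
  | succ t ih =>
    intro ht
    rw [← (auxEquiv G t).sum_comp, Fintype.sum_prod_type]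
    have e : ∀ h : G.Hist t, ∑ q : G.JointAct × G.S × G.ObsTuple,
        G.histProb π (t + 1) (auxEquiv G t (h, q)) =
        ∑ a, ∑ s, ∑ z, G.histProb π (t + 1) (G.extend h a s z) := by
      intro h
      simp_rw [Fintype.sum_prod_type]
      rfl
    rw [Finset.sum_congr rfl fun h _ => e h]
    change ∑ h, ∑ a, ∑ s, ∑ z, G.histProb π (t + 1) (G.extend h a s z) = 1
    simp_rw [aux_histProb_extend, ← Finset.mul_sum, G.Obs_sum, mul_one, ← Finset.mul_sum,
      G.Tr_sum, mul_one, ← Finset.mul_sum, aux_polProb_sum G π hπ (show t < G.T by omega), mul_one]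
    exact ih (by omega)

theorem aux_reach_nonneg (G : POSG) (π : G.JointPolicy) (hπ : G.IsJointPolicy π)
    (i : Fin G.n) {t : ℕ} (x : G.LocTraj i t) : 0 ≤ G.reach π i x := by
  unfold POSG.reach
  refine Finset.sum_nonneg fun h _ => ?_
  split_ifs
  · exact aux_histProb_nonneg G π hπ t h
  · exact le_rfl

theorem aux_reach_sum (G : POSG) (π : G.JointPolicy) (hπ : G.IsJointPolicy π)
    (i : Fin G.n) {t : ℕ} (ht : t ≤ G.T) : ∑ x : G.LocTraj i t, G.reach π i x = 1 := by
  unfold POSG.reach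
  rw [Finset.sum_comm, ← aux_histProb_sum G π hπ t ht]
  refine Finset.sum_congr rfl fun h _ => ?_
  rw [Finset.sum_ite_eq]
  simp

/-- **Deviation bound for modification-L Nash distributions.**  Every Nash distribution
`π̄_L` with modification-L (parameter `ε ≥ 0`) is an `ε'`-Nash equilibrium with
`ε' = ε · log|A| · ∑_{k=0}^{T-1} γ^k`. -/
theorem nashDistL_deviation_bound (G : POSG) (ε : ℝ) (hε : 0 ≤ ε)
    (πL : G.JointPolicy) (hπL : G.IsJointPolicy πL) (hL : G.NashDistL ε πL) :
    ∀ (i : Fin G.n) (p : G.Policy i), G.IsPolicy p →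
      G.u (Function.update πL i p) i - G.u πL i ≤
        ε * Real.log (Fintype.card G.A) * ∑ k ∈ Finset.range G.T, G.γ ^ k := by
  intro i p hp
  have h := hL i p hp
  have h1 : G.entReg ε p πL ≤ 0 := by
    unfold POSG.entReg
    refine mul_nonpos_of_nonneg_of_nonpos hε (Finset.sum_nonpos fun t _ => ?_)
    refine mul_nonpos_of_nonneg_of_nonpos (pow_nonneg G.γ_pos.le _)
      (Finset.sum_nonpos fun x _ => ?_)
    exact mul_nonpos_of_nonpos_of_nonneg (aux_negEnt_nonpos _ (hp.1 t x) (hp.2 t x))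
      (aux_reach_nonneg G πL hπL i x)
  have h2 : -(ε * Real.log (Fintype.card G.A) * ∑ k ∈ Finset.range G.T, G.γ ^ k) ≤
      G.entReg ε (πL i) πL := by
    unfold POSG.entReg
    rw [mul_assoc, ← mul_neg]
    refine mul_le_mul_of_nonneg_left ?_ hε
    rw [← Fin.sum_univ_eq_sum_range (fun k => G.γ ^ k), ← neg_mul, Finset.mul_sum]
    refine Finset.sum_le_sum fun t _ => ?_
    rw [mul_comm]
    refine mul_le_mul_of_nonneg_left ?_ (pow_nonneg G.γ_pos.le _)
    rw [← mul_one (-Real.log _), ← aux_reach_sum G πL hπL i t.2.le, Finset.mul_sum]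
    refine Finset.sum_le_sum fun x _ => ?_
    exact mul_le_mul_of_nonneg_right
      (aux_negEnt_lower _ ((hπL i).1 t x) ((hπL i).2 t x)) (aux_reach_nonneg G πL hπL i x)
  linarith
end
end
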